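/- arXiv:2106.00678 — 9 statements merged into one kernel-verified Lean document; each statement's English description precedes it below -/
import Mathlib

section
/- Let 𝒰 be a covering uniformity on a frame L and ◁ its uniformly below relation. Then ◁ interpolates: if a ◁ b then there exists c ∈ L with a ◁ c and c ◁ b. -/
/-- A covering downset on a frame: a lower set whose supremum is the top element. -/
def IsCoveringDownset {L : Type*} [Order.Frame L] (C : Set L) : Prop :=
  IsLowerSet C ∧ sSup C = ⊤

/-- The star of `a` with respect to `D`: the join of all members of `D` meeting `a`. -/
def frameStar {L : Type*} [Order.Frame L] (a : L) (D : Set L) : L :=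
  sSup {u | u ∈ D ∧ a ⊓ u ≠ ⊥}

/-- `U⋆`: the lower closure of the set of stars of members of `U`. -/
def starCover {L : Type*} [Order.Frame L] (U : Set L) : Set L :=
  {x | ∃ u ∈ U, x ≤ frameStar u U}

/-- A covering uniformity on a frame. -/
def IsCoveringUniformity {L : Type*} [Order.Frame L] (𝒰 : Set (Set L)) : Prop :=
  𝒰.Nonempty ∧
  (∀ U ∈ 𝒰, IsCoveringDownset U) ∧
  (∀ U ∈ 𝒰, ∀ U' : Set L, IsCoveringDownset U' → U ⊆ U' → U' ∈ 𝒰) ∧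
  (∀ U ∈ 𝒰, ∀ V ∈ 𝒰, U ∩ V ∈ 𝒰) ∧
  (∀ U ∈ 𝒰, ∃ V ∈ 𝒰, starCover V ⊆ U)

/-- The uniformly below relation of a covering uniformity. -/
def UBelow {L : Type*} [Order.Frame L] (𝒰 : Set (Set L)) (a b : L) : Prop :=
  ∃ U ∈ 𝒰, frameStar a U ≤ b

/-- `↓f[S]`: the lower closure of the image of `S` under `f`. -/
def imgDown {α β : Type*} [LE β] (f : α → β) (S : Set α) : Set β :=
  {b | ∃ s ∈ S, b ≤ f s}

theorem le_frameStar {L : Type*} [Order.Frame L] {a u : L} {D : Set L}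
    (hu : u ∈ D) (h : a ⊓ u ≠ ⊥) : u ≤ frameStar a D :=
  le_sSup ⟨hu, h⟩

/-- If `V` star-refines `U`, then the double star along `V` lies below the star along `U`. -/
theorem frameStar_frameStar_le {L : Type*} [Order.Frame L] {U V : Set L}
    (hVU : starCover V ⊆ U) (a : L) :
    frameStar (frameStar a V) V ≤ frameStar a U := by
  refine sSup_le ?_
  rintro v ⟨hv, hne⟩
  obtain ⟨w, ⟨hw, haw⟩, hwv⟩ : ∃ w ∈ {u | u ∈ V ∧ a ⊓ u ≠ ⊥}, w ⊓ v ≠ ⊥ := by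
    contrapose! hne
    rw [frameStar, sSup_inf_eq]
    simpa only [iSup_eq_bot] using hne
  have hw_ne : w ⊓ w ≠ ⊥ := fun h => haw (by rw [← inf_idem w, h, inf_bot_eq])
  have hstar : a ⊓ frameStar w V ≠ ⊥ :=
    ne_bot_of_le_ne_bot haw (inf_le_inf_left a (le_frameStar hw hw_ne))
  exact (le_frameStar hv hwv).trans (le_frameStar (hVU ⟨w, hw, le_rfl⟩) hstar)

theorem uniformlyBelow_interpolates {L : Type*} [Order.Frame L]
    (𝒰 : Set (Set L)) (h𝒰 : IsCoveringUniformity 𝒰)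
    (a b : L) (hab : UBelow 𝒰 a b) :
    ∃ c : L, UBelow 𝒰 a c ∧ UBelow 𝒰 c b := by
  obtain ⟨U, hU, hUb⟩ := hab
  obtain ⟨V, hV, hVU⟩ := h𝒰.2.2.2.2 U hU
  exact ⟨frameStar a V, ⟨V, hV, le_rfl⟩, V, hV, (frameStar_frameStar_le hVU a).trans hUb⟩
end

section
/- Let 𝒰 be a covering uniformity on a frame L and ◁ its uniformly below relation. Then a ◁ b implies a ≺ b (a is rather below b). Consequently, if 𝒰 is admissible, then L is regular: b = sSup {a | a ≺ b} for every b ∈ L. (Classical rendering of the proposition that uniform locales are weakly regular.) -/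
/-- If `D` covers `⊤`, every `b` above the star of `a` is complemented, away from `a`, by the join
of the members of `D` disjoint from `a`. -/
theorem exists_inf_eq_bot_sup_eq_top_of_frameStar_le {L : Type*} [Order.Frame L] {a b : L}
    {D : Set L} (hD : sSup D = ⊤) (h : frameStar a D ≤ b) : ∃ c : L, c ⊓ a = ⊥ ∧ c ⊔ b = ⊤ := by
  refine ⟨sSup {u | u ∈ D ∧ a ⊓ u = ⊥}, ?_, ?_⟩
  · rw [sSup_inf_eq, eq_bot_iff]
    exact iSup₂_le fun u hu => by rw [inf_comm, hu.2]
  · rw [eq_top_iff, ← hD]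
    refine sSup_le fun u hu => ?_
    by_cases hau : a ⊓ u = ⊥
    · exact le_sup_of_le_left (le_sSup ⟨hu, hau⟩)
    · exact le_sup_of_le_right ((le_sSup ⟨hu, hau⟩ : u ≤ frameStar a D).trans h)

theorem uniformlyBelow_ratherBelow_and_regular {L : Type*} [Order.Frame L]
    (𝒰 : Set (Set L)) (h𝒰 : IsCoveringUniformity 𝒰) :
    (∀ a b : L, UBelow 𝒰 a b → ∃ c : L, c ⊓ a = ⊥ ∧ c ⊔ b = ⊤) ∧
    ((∀ b : L, b = sSup {a | UBelow 𝒰 a b}) →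
      ∀ b : L, b = sSup {a | ∃ c : L, c ⊓ a = ⊥ ∧ c ⊔ b = ⊤}) := by
  have ratherBelow : ∀ a b : L, UBelow 𝒰 a b → ∃ c : L, c ⊓ a = ⊥ ∧ c ⊔ b = ⊤ := by
    rintro a b ⟨U, hU, hab⟩
    exact exists_inf_eq_bot_sup_eq_top_of_frameStar_le (h𝒰.2.1 U hU).2 hab
  refine ⟨ratherBelow, fun hadm b => le_antisymm ?_ (sSup_le ?_)⟩
  · exact (hadm b).le.trans (sSup_le_sSup fun a => ratherBelow a b)
  · rintro a ⟨c, hca, hcb⟩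
    exact (disjoint_iff.mpr hca).symm.le_of_codisjoint (codisjoint_iff.mpr hcb)
end

section
/- Let 𝒰 be a covering uniformity on a frame L and ◁ its uniformly below relation, and define r : L → L by r(b) = sSup {a | a ◁ b}. Then r is a conucleus: r(b) ≤ b for all b; r is monotone; r(r(b)) = r(b); r(⊤) = ⊤; and r(b ⊓ b') = r(b) ⊓ r(b') for all b, b'. (Key step in the proof that uniform locales form a reflective subcategory of pre-uniform locales.) -/
section Star

variable {L : Type*} [Order.Frame L] {a b : L} {U V : Set L}

theorem le_frameStar_of_mem (hb : b ∈ U) (h : a ⊓ b ≠ ⊥) : b ≤ frameStar a U :=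
  le_sSup ⟨hb, h⟩

theorem frameStar_mono (hab : a ≤ b) (hUV : U ⊆ V) : frameStar a U ≤ frameStar b V :=
  sSup_le_sSup fun _ hu =>
    ⟨hUV hu.1, fun h => hu.2 (le_bot_iff.1 ((inf_le_inf_right _ hab).trans h.le))⟩

theorem IsCoveringDownset.le_frameStar (hU : IsCoveringDownset U) (a : L) :
    a ≤ frameStar a U := by
  calc a = a ⊓ sSup U := by rw [hU.2, inf_top_eq]
    _ = ⨆ u ∈ U, a ⊓ u := inf_sSup_eq
    _ ≤ frameStar a U := iSup₂_le fun u hu => by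
      by_cases h : a ⊓ u = ⊥
      · rw [h]
        exact bot_le
      · exact inf_le_right.trans (le_frameStar_of_mem hu h)

end Star

section UBelow

variable {L : Type*} [Order.Frame L] {𝒰 : Set (Set L)} {a a' b b' : L}

theorem UBelow.le (h𝒰 : IsCoveringUniformity 𝒰) (h : UBelow 𝒰 a b) : a ≤ b := by
  obtain ⟨U, hU, hab⟩ := h
  exact ((h𝒰.2.1 U hU).le_frameStar a).trans hab

theorem UBelow.trans_le (h : UBelow 𝒰 a b) (hb : b ≤ b') : UBelow 𝒰 a b' := by
  obtain ⟨U, hU, hab⟩ := h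
  exact ⟨U, hU, hab.trans hb⟩

theorem IsCoveringUniformity.uBelow_top (h𝒰 : IsCoveringUniformity 𝒰) (a : L) :
    UBelow 𝒰 a ⊤ := by
  obtain ⟨U, hU⟩ := h𝒰.1
  exact ⟨U, hU, le_top⟩

theorem UBelow.inf (h𝒰 : IsCoveringUniformity 𝒰) (h : UBelow 𝒰 a b) (h' : UBelow 𝒰 a' b') :
    UBelow 𝒰 (a ⊓ a') (b ⊓ b') := by
  obtain ⟨U, hU, hab⟩ := h
  obtain ⟨U', hU', hab'⟩ := h'
  exact ⟨U ∩ U', h𝒰.2.2.2.1 U hU U' hU', le_inf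
    ((frameStar_mono inf_le_left Set.inter_subset_left).trans hab)
    ((frameStar_mono inf_le_right Set.inter_subset_right).trans hab')⟩

/-- An element uniformly below `b` is uniformly below the join of all such elements. -/
theorem UBelow.sSup_uBelow (h𝒰 : IsCoveringUniformity 𝒰) (h : UBelow 𝒰 a b) :
    UBelow 𝒰 a (sSup {c | UBelow 𝒰 c b}) := by
  obtain ⟨U, hU, hab⟩ := h
  obtain ⟨V, hV, hVU⟩ := h𝒰.2.2.2.2 U hU
  refine ⟨V, hV, sSup_le_sSup fun v hv => ⟨V, hV, ?_⟩⟩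
  refine (le_frameStar_of_mem (hVU ⟨v, hv.1, le_rfl⟩) fun h => hv.2 ?_).trans hab
  exact le_bot_iff.1 ((inf_le_inf_left a ((h𝒰.2.1 V hV).le_frameStar v)).trans h.le)

end UBelow

theorem uniformlyBelow_conucleus {L : Type*} [Order.Frame L]
    (𝒰 : Set (Set L)) (h𝒰 : IsCoveringUniformity 𝒰)
    (r : L → L) (hr : ∀ b, r b = sSup {a | UBelow 𝒰 a b}) :
    (∀ b, r b ≤ b) ∧ Monotone r ∧ (∀ b, r (r b) = r b) ∧
    r ⊤ = ⊤ ∧ (∀ b b' : L, r (b ⊓ b') = r b ⊓ r b') := by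
  have le_r {a b : L} (h : UBelow 𝒰 a b) : a ≤ r b := (hr b).symm ▸ le_sSup h
  have r_le {b c : L} (h : ∀ a, UBelow 𝒰 a b → a ≤ c) : r b ≤ c := (hr b).symm ▸ sSup_le h
  have r_le_self (b : L) : r b ≤ b := r_le fun _ h => h.le h𝒰
  have r_mono : Monotone r := fun _ _ hb => r_le fun _ h => le_r (h.trans_le hb)
  refine ⟨r_le_self, r_mono, fun b => le_antisymm (r_le_self _) (r_le fun a h => le_r ?_),
    top_le_iff.1 (le_r (h𝒰.uBelow_top ⊤)), fun b b' => le_antisymm (r_mono.map_inf_le b b') ?_⟩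
  · rw [hr b]
    exact h.sSup_uBelow h𝒰
  · rw [hr b, hr b', sSup_inf_sSup]
    exact iSup₂_le fun p hp => le_r (UBelow.inf h𝒰 hp.1 hp.2)
end

section
/- Let 𝒰 be a covering uniformity on a frame L and ◁ its uniformly below relation. Then the set R = {b ∈ L | b ≤ sSup {a | a ◁ b}} is a subframe of L: it contains ⊥ and ⊤, is closed under binary meets, and is closed under arbitrary suprema (if S ⊆ R then sSup S ∈ R). -/
theorem frameStar_mono_s6 {L : Type*} [Order.Frame L] {a b : L} {D E : Set L}
    (hab : a ≤ b) (hDE : D ⊆ E) : frameStar a D ≤ frameStar b E :=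
  sSup_le_sSup fun _ hu =>
    ⟨hDE hu.1, fun h => hu.2 (le_bot_iff.mp ((inf_le_inf_right _ hab).trans h.le))⟩

theorem UBelow.mono_right {L : Type*} [Order.Frame L] {𝒰 : Set (Set L)} {a b c : L}
    (hab : UBelow 𝒰 a b) (hbc : b ≤ c) : UBelow 𝒰 a c :=
  let ⟨U, hU, h⟩ := hab
  ⟨U, hU, h.trans hbc⟩

theorem UBelow.inf_s6 {L : Type*} [Order.Frame L] {𝒰 : Set (Set L)}
    (h𝒰 : ∀ U ∈ 𝒰, ∀ V ∈ 𝒰, U ∩ V ∈ 𝒰) {a b c d : L}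
    (hac : UBelow 𝒰 a c) (hbd : UBelow 𝒰 b d) : UBelow 𝒰 (a ⊓ b) (c ⊓ d) :=
  let ⟨U, hU, hUc⟩ := hac
  let ⟨V, hV, hVd⟩ := hbd
  ⟨U ∩ V, h𝒰 U hU V hV,
    le_inf ((frameStar_mono_s6 inf_le_left Set.inter_subset_left).trans hUc)
      ((frameStar_mono_s6 inf_le_right Set.inter_subset_right).trans hVd)⟩

theorem fixedPoints_subframe {L : Type*} [Order.Frame L]
    (𝒰 : Set (Set L)) (h𝒰 : IsCoveringUniformity 𝒰)
    (R : Set L) (hR : R = {b | b ≤ sSup {a | UBelow 𝒰 a b}}) :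
    ⊥ ∈ R ∧ ⊤ ∈ R ∧ (∀ a b : L, a ∈ R → b ∈ R → a ⊓ b ∈ R) ∧
    (∀ S : Set L, S ⊆ R → sSup S ∈ R) := by
  subst hR
  obtain ⟨⟨U, hU⟩, -, -, h_inter, -⟩ := h𝒰
  refine ⟨bot_le, le_sSup ⟨U, hU, le_top⟩, fun a b ha hb => ?_, fun S hS => ?_⟩
  · refine (inf_le_inf ha hb).trans ?_
    rw [sSup_inf_sSup]
    exact iSup₂_le fun p hp => le_sSup (UBelow.inf_s6 h_inter hp.1 hp.2)
  · exact sSup_le fun b hb =>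
      (hS hb).trans (sSup_le_sSup fun _ hx => hx.mono_right (le_sSup hb))
end

section
/- Let L be a frame and a₀, a₁, a₂, a₃ ∈ L with a₀ ≺ a₁ ≺ a₂ ≺ a₃ (each rather below the next). Let C be the intersection of the lower closures ↓{a₀ᶜ, a₁} ∩ ↓{a₁ᶜ, a₂} ∩ ↓{a₂ᶜ, a₃}, where xᶜ denotes the pseudocomplement. Then C is a covering downset on L and C⋆ ⊆ ↓{a₀ᶜ, a₃}; i.e., C star-refines the cover ↓{a₀ᶜ, a₃}. (Key computation in the proof that strongly regular locales are uniformisable.) -/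
theorem IsCoveringDownset.inter {L : Type*} [Order.Frame L] {C D : Set L}
    (hC : IsCoveringDownset C) (hD : IsCoveringDownset D) : IsCoveringDownset (C ∩ D) := by
  refine ⟨hC.1.inter hD.1, top_le_iff.mp ?_⟩
  calc ⊤ = sSup C ⊓ sSup D := by rw [hC.2, hD.2, inf_top_eq]
    _ ≤ sSup (C ∩ D) := by
      rw [sSup_inf_sSup]
      exact iSup₂_le fun p hp =>
        le_sSup ⟨hC.1 inf_le_left hp.1, hD.1 inf_le_right hp.2⟩

theorem isCoveringDownset_pair {L : Type*} [Order.Frame L] {p q : L} (h : p ⊔ q = ⊤) :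
    IsCoveringDownset {z | z ≤ p ∨ z ≤ q} :=
  ⟨fun _ _ hba => Or.imp hba.trans hba.trans,
    top_le_iff.mp (h ▸ sup_le (le_sSup (Or.inl le_rfl)) (le_sSup (Or.inr le_rfl)))⟩

theorem frameStar_le {L : Type*} [Order.Frame L] {a b : L} {D : Set L}
    (h : ∀ v ∈ D, ¬ Disjoint a v → v ≤ b) : frameStar a D ≤ b :=
  sSup_le fun v hv => h v hv.1 (by rw [disjoint_iff]; exact hv.2)

theorem three_step_star_refinement {L : Type*} [Order.Frame L]
    (pc : L → L) (hpc : ∀ a : L, pc a = sSup {c | c ⊓ a = ⊥})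
    (a₀ a₁ a₂ a₃ : L)
    (h01 : ∃ c : L, c ⊓ a₀ = ⊥ ∧ c ⊔ a₁ = ⊤)
    (h12 : ∃ c : L, c ⊓ a₁ = ⊥ ∧ c ⊔ a₂ = ⊤)
    (h23 : ∃ c : L, c ⊓ a₂ = ⊥ ∧ c ⊔ a₃ = ⊤)
    (C : Set L)
    (hC : C = {z | z ≤ pc a₀ ∨ z ≤ a₁} ∩ {z | z ≤ pc a₁ ∨ z ≤ a₂} ∩
              {z | z ≤ pc a₂ ∨ z ≤ a₃}) :
    IsCoveringDownset C ∧ starCover C ⊆ {z | z ≤ pc a₀ ∨ z ≤ a₃} := by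
  have disjoint_pc (a : L) : Disjoint (pc a) a := by
    rw [hpc, sSup_disjoint_iff]
    exact fun c hc => disjoint_iff.mpr hc
  have pc_sup {a b : L} (h : ∃ c : L, c ⊓ a = ⊥ ∧ c ⊔ b = ⊤) : pc a ⊔ b = ⊤ := by
    obtain ⟨c, hca, hcb⟩ := h
    refine top_le_iff.mp (hcb ▸ sup_le_sup_right ?_ b)
    rw [hpc]
    exact le_sSup hca
  subst hC
  refine ⟨((isCoveringDownset_pair (pc_sup h01)).inter
    (isCoveringDownset_pair (pc_sup h12))).inter (isCoveringDownset_pair (pc_sup h23)), ?_⟩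
  rintro x ⟨u, ⟨⟨-, hu⟩, -⟩, hx⟩
  refine hu.imp (fun hu => hx.trans (frameStar_le ?_)) (fun hu => hx.trans (frameStar_le ?_))
  · rintro v ⟨⟨hv, -⟩, -⟩ hne
    exact hv.resolve_right fun hv => hne ((disjoint_pc a₁).mono hu hv)
  · rintro v ⟨-, hv⟩ hne
    exact hv.resolve_left fun hv => hne ((disjoint_pc a₂).symm.mono hu hv)
end

section
/- Let A, B, C be frames, h : B → A a dense frame homomorphism, and f, g : C → B frame homomorphisms with h ∘ f = h ∘ g. If C is regular, then f = g. (Classical rendering of the corollary that strongly dense uniform maps are epic, since uniform locales are regular classically.) -/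
/-- If two frame homomorphisms agree after composition with a dense one, then the first is bounded
by the second on every pair of elements in the rather-below relation. -/
theorem map_le_map_of_ratherBelow {A B C : Type*} [Order.Frame A] [Order.Frame B] [Order.Frame C]
    (h : FrameHom B A) (hdense : ∀ b : B, h b = ⊥ → b = ⊥)
    (f g : FrameHom C B) (hfg : ∀ c : C, h (f c) = h (g c))
    {a c d : C} (hda : d ⊓ a = ⊥) (hdc : d ⊔ c = ⊤) : f a ≤ g c := by
  have hdisj : Disjoint (f a) (g d) := by
    rw [disjoint_iff]
    apply hdense
    rw [map_inf, ← hfg, ← map_inf, ← map_inf, inf_comm, hda, map_bot, map_bot]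
  refine hdisj.le_of_codisjoint ?_
  rw [codisjoint_iff, ← map_sup, hdc, map_top]

/-- On a regular frame, frame homomorphisms that agree after composition with a dense one
are comparable. -/
theorem map_le_map_of_dense_of_regular {A B C : Type*}
    [Order.Frame A] [Order.Frame B] [Order.Frame C]
    (h : FrameHom B A) (hdense : ∀ b : B, h b = ⊥ → b = ⊥)
    (f g : FrameHom C B) (hfg : ∀ c : C, h (f c) = h (g c))
    (hreg : ∀ c : C, c = sSup {a | ∃ d : C, d ⊓ a = ⊥ ∧ d ⊔ c = ⊤}) (c : C) :
    f c ≤ g c := by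
  conv_lhs => rw [hreg c]
  rw [map_sSup]
  refine sSup_le ?_
  rintro _ ⟨a, ⟨d, hda, hdc⟩, rfl⟩
  exact map_le_map_of_ratherBelow h hdense f g hfg hda hdc

theorem dense_epic {A B C : Type*} [Order.Frame A] [Order.Frame B] [Order.Frame C]
    (h : FrameHom B A) (hdense : ∀ b : B, h b = ⊥ → b = ⊥)
    (f g : FrameHom C B) (hfg : ∀ c : C, h (f c) = h (g c))
    (hreg : ∀ c : C, c = sSup {a | ∃ d : C, d ⊓ a = ⊥ ∧ d ⊔ c = ⊤}) :
    f = g := by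
  ext c
  exact le_antisymm (map_le_map_of_dense_of_regular h hdense f g hfg hreg c)
    (map_le_map_of_dense_of_regular h hdense g f (fun c => (hfg c).symm) hreg c)
end

section
/- Let j : B → A be a surjective dense frame homomorphism with right adjoint j⁎, let 𝒱 be a covering uniformity on B, and let 𝒰 be the initial (embedding) uniformity on A, i.e. 𝒰 = {U | U is a covering downset on A and ↓j[V] ⊆ U for some V ∈ 𝒱}. Then for every U ∈ 𝒰 the lower closure ↓j⁎[U] belongs to 𝒱, and for every V ∈ 𝒱 there exists U ∈ 𝒰 with ↓j⁎[U] ⊆ V; i.e., the downsets ↓j⁎[U] for U ∈ 𝒰 form a base for 𝒱. (Classical rendering of: for a strongly dense embedding of pre-uniform locales, the direct images of uniform covers form a base of the ambient uniformity.) -/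
/-- For a dense frame homomorphism `j`, if `j c ≤ j w` then `c` lies below the star of `w` in any
cover. -/
theorem le_frameStar_of_map_le {A B : Type*} [Order.Frame A] [Order.Frame B]
    (j : FrameHom B A) (hdense : ∀ b : B, j b = ⊥ → b = ⊥) {W : Set B} (hW : sSup W = ⊤)
    {c w : B} (h : j c ≤ j w) : c ≤ frameStar w W := by
  rw [← inf_top_eq c, ← hW, inf_sSup_eq]
  refine iSup₂_le fun u hu => ?_
  by_cases hwu : w ⊓ u = ⊥
  · have hcu : c ⊓ u = ⊥ := by
      refine hdense _ (le_bot_iff.mp ?_)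
      calc j (c ⊓ u) = j c ⊓ j u := map_inf j c u
        _ ≤ j w ⊓ j u := inf_le_inf_right _ h
        _ = ⊥ := by rw [← map_inf, hwu, map_bot]
    exact hcu.trans_le bot_le
  · exact inf_le_right.trans (le_sSup ⟨hu, hwu⟩)

theorem isLowerSet_imgDown {α β : Type*} [Preorder β] (f : α → β) (S : Set α) :
    IsLowerSet (imgDown f S) :=
  fun _ _ hba ⟨s, hs, has⟩ => ⟨s, hs, hba.trans has⟩

/-- The lower closure of the image of a cover under a frame homomorphism is a covering downset. -/
theorem isCoveringDownset_imgDown {A B : Type*} [Order.Frame A] [Order.Frame B]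
    (j : FrameHom B A) {W : Set B} (hW : sSup W = ⊤) : IsCoveringDownset (imgDown j W) := by
  refine ⟨isLowerSet_imgDown j W, top_le_iff.mp ?_⟩
  rw [← map_top j, ← hW, map_sSup]
  exact sSup_le_sSup fun _ ⟨w, hw, hwx⟩ => ⟨w, hw, hwx.ge⟩

theorem dense_embedding_images_form_base {A B : Type*} [Order.Frame A] [Order.Frame B]
    (j : FrameHom B A) (hsurj : Function.Surjective j)
    (hdense : ∀ b : B, j b = ⊥ → b = ⊥)
    (jstar : A → B) (hadj : ∀ (a : A) (b : B), j b ≤ a ↔ b ≤ jstar a)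
    (𝒱 : Set (Set B)) (h𝒱 : IsCoveringUniformity 𝒱)
    (𝒰 : Set (Set A))
    (h𝒰 : 𝒰 = {U | IsCoveringDownset U ∧ ∃ V ∈ 𝒱, imgDown j V ⊆ U}) :
    (∀ U ∈ 𝒰, imgDown jstar U ∈ 𝒱) ∧
    (∀ V ∈ 𝒱, ∃ U ∈ 𝒰, imgDown jstar U ⊆ V) := by
  obtain ⟨-, hcov, hup, -, hstar⟩ := h𝒱
  subst h𝒰
  constructor
  · rintro U ⟨-, V, hV, hVU⟩
    have hsub : V ⊆ imgDown jstar U := fun v hv =>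
      ⟨j v, hVU ⟨v, hv, le_rfl⟩, (hadj _ _).mp le_rfl⟩
    refine hup V hV _ ⟨isLowerSet_imgDown jstar U, top_le_iff.mp ?_⟩ hsub
    exact (hcov V hV).2.ge.trans (sSup_le_sSup hsub)
  · intro V hV
    obtain ⟨W, hW, hWV⟩ := hstar V hV
    have hWtop := (hcov W hW).2
    refine ⟨imgDown j W, ⟨isCoveringDownset_imgDown j hWtop, W, hW, subset_rfl⟩, ?_⟩
    rintro x ⟨a, ⟨w, hw, haw⟩, hxa⟩
    exact hWV ⟨w, hw, le_frameStar_of_map_le j hdense hWtop (((hadj a x).mpr hxa).trans haw)⟩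
end

section
/- Let j : B → A be a surjective dense frame homomorphism with right adjoint j⁎. Then for every subset V ⊆ A and every v ∈ A, st(j⁎(v), ↓j⁎[V]) ≤ j⁎(st(v, V)). (Key claim in the construction of the pre-uniform structure on the locale of Cauchy filters.) -/
theorem star_of_right_adjoint_le {A B : Type*} [Order.Frame A] [Order.Frame B]
    (j : FrameHom B A) (hsurj : Function.Surjective j)
    (hdense : ∀ b : B, j b = ⊥ → b = ⊥)
    (jstar : A → B) (hadj : ∀ (a : A) (b : B), j b ≤ a ↔ b ≤ jstar a)
    (V : Set A) (v : A) :
    frameStar (jstar v) (imgDown jstar V) ≤ jstar (frameStar v V) := by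
  refine sSup_le fun u hu => ?_
  obtain ⟨⟨s, hs, hus⟩, hne⟩ := hu
  have hmeet : v ⊓ s ≠ ⊥ := fun h => hne <| hdense _ <| le_bot_iff.mp <| by
    rw [map_inf, ← h]
    exact inf_le_inf ((hadj v _).mpr le_rfl) ((hadj s u).mpr hus)
  exact (hadj _ _).mp (((hadj s u).mpr hus).trans (le_sSup ⟨hs, hmeet⟩))
end

section
/- Let j : B → A be a surjective dense frame homomorphism with right adjoint j⁎, let 𝒰 be a covering uniformity on A with uniformly below relation ◁_A, and let 𝒱 be a covering uniformity on B such that ↓j⁎[U] ∈ 𝒱 for every U ∈ 𝒰, with uniformly below relation ◁_B. Then v ◁_A u implies j⁎(v) ◁_B j⁎(u). (Claim used to prove admissibility of the uniformity on the completion.) -/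
theorem right_adjoint_preserves_uniformlyBelow {A B : Type*}
    [Order.Frame A] [Order.Frame B]
    (j : FrameHom B A) (hsurj : Function.Surjective j)
    (hdense : ∀ b : B, j b = ⊥ → b = ⊥)
    (jstar : A → B) (hadj : ∀ (a : A) (b : B), j b ≤ a ↔ b ≤ jstar a)
    (𝒰 : Set (Set A)) (h𝒰 : IsCoveringUniformity 𝒰)
    (𝒱 : Set (Set B)) (h𝒱 : IsCoveringUniformity 𝒱)
    (hbase : ∀ U ∈ 𝒰, imgDown jstar U ∈ 𝒱)
    (v u : A) (h : UBelow 𝒰 v u) :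
    UBelow 𝒱 (jstar v) (jstar u) := by
  obtain ⟨U, hU, hvu⟩ := h
  refine ⟨imgDown jstar U, hbase U hU, sSup_le ?_⟩
  rintro w ⟨⟨s, hs, hws⟩, hmeet⟩
  rw [← hadj] at hws ⊢
  have hvs : v ⊓ s ≠ ⊥ := fun hbot => hmeet <| hdense _ <| le_bot_iff.mp <| by
    rw [map_inf, ← hbot]
    exact inf_le_inf ((hadj v _).mpr le_rfl) hws
  have hsv : s ≤ frameStar v U := le_sSup ⟨hs, hvs⟩
  exact hws.trans (hsv.trans hvu)
end
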